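/- (Twisted left linearity of the longest odd divided difference operator; corollary of the Omission Word Lemma.) For every odd symmetric polynomial f ∈ OΛ_a and every g ∈ OPol_a, D_a(f·g) = w_0(f)·D_a(g), where w_0 is the longest element of S_a acting via the signed permutation action. -/

import Mathlib

open scoped BigOperators

/-- The defining anticommutation relations of the odd polynomial ring. -/
inductive OddRel (a : ℕ) : FreeAlgebra ℤ (Fin a) → FreeAlgebra ℤ (Fin a) → Prop
  | anticomm (i j : Fin a) (h : i ≠ j) :
      OddRel a (FreeAlgebra.ι ℤ i * FreeAlgebra.ι ℤ j)
        (-(FreeAlgebra.ι ℤ j * FreeAlgebra.ι ℤ i))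

/-- The ring of odd polynomials in `a` variables over `ℤ`. -/
abbrev OPol (a : ℕ) : Type := RingQuot (OddRel a)

/-- The variable `x_{i+1}` (`0`-based index). -/
noncomputable def OX {a : ℕ} (i : Fin a) : OPol a :=
  RingQuot.mkRingHom (OddRel a) (FreeAlgebra.ι ℤ i)

/-- The variable `x_i` (`1`-based index), `0` if out of range. -/
noncomputable def xv (a : ℕ) (i : ℕ) : OPol a :=
  if h : 1 ≤ i ∧ i ≤ a then OX ⟨i - 1, by omega⟩ else 0

/-- The signed variable `x̃_i = (−1)^{i−1} x_i` (`0`-based index, so the sign is `(−1)^i`). -/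
noncomputable def xt (a : ℕ) (i : Fin a) : OPol a := (-1 : OPol a) ^ (i : ℕ) * OX i

/-- Odd elementary symmetric polynomial `ε_k`. -/
noncomputable def eps (a k : ℕ) : OPol a :=
  ∑ t ∈ Finset.powersetCard k (Finset.univ : Finset (Fin a)),
    ((t.sort (· ≤ ·)).map (xt a)).prod

/-- Odd complete symmetric polynomial `h_k`. -/
noncomputable def hp (a k : ℕ) : OPol a :=
  ∑ σ : Sym (Fin a) k, (((σ : Multiset (Fin a)).sort (· ≤ ·)).map (xt a)).prod

/-- The ordered monomial `x_1^{c_1} ⋯ x_a^{c_a}`. -/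
noncomputable def xmon {a : ℕ} (c : Fin a → ℕ) : OPol a :=
  ((List.finRange a).map fun i => OX i ^ c i).prod

/-- The staircase monomial `x^{δ_a} = x_1^{a−1} x_2^{a−2} ⋯ x_a^0`. -/
noncomputable def xdelta (a : ℕ) : OPol a :=
  ((List.finRange a).map fun i => OX i ^ (a - 1 - (i : ℕ))).prod

/-- Composite of the operators `d i` along a word, leftmost letter acting last (outermost). -/
noncomputable def dword {a : ℕ} (d : ℕ → OPol a →+ OPol a) : List ℕ → (OPol a →+ OPol a)
  | [] => AddMonoidHom.id _
  | i :: l => (d i).comp (dword d l)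

/-- The word `1, (2,1), (3,2,1), …, (a−1,…,2,1)` for the longest element, so that
`dword d (DList a) = ∂_1∘(∂_2∘∂_1)∘⋯∘(∂_{a−1}∘⋯∘∂_1) = D_a`. -/
def DList (a : ℕ) : List ℕ :=
  ((List.range a).map fun b => (List.range b).reverse.map (· + 1)).flatten

/-- Left multiplication by `f` as a `ℤ`-linear endomorphism. -/
noncomputable def mulL {a : ℕ} (f : OPol a) : Module.End ℤ (OPol a) :=
  (AddMonoidHom.mulLeft f).toIntLinearMap

/-- The generators of the odd nilHecke ring inside `End_ℤ(OPol a)`. -/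
noncomputable def onhGens (a : ℕ) (d : ℕ → OPol a →+ OPol a) :
    Set (Module.End ℤ (OPol a)) :=
  {T | (∃ i : Fin a, T = mulL (OX i)) ∨
    (∃ i : ℕ, 1 ≤ i ∧ i + 1 ≤ a ∧ T = (d i).toIntLinearMap)}

/-- The simple transposition `s_i` (`1`-based) of `{1,…,a}`. -/
def sperm (a : ℕ) (i : ℕ) : Equiv.Perm (Fin a) :=
  if h : 1 ≤ i ∧ i + 1 ≤ a then Equiv.swap ⟨i - 1, by omega⟩ ⟨i, by omega⟩ else 1

/-- The permutation associated to a word in the simple transpositions. -/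
def wordPerm (a : ℕ) (l : List ℕ) : Equiv.Perm (Fin a) := (l.map (sperm a)).prod

/-- Evaluation of an (even) multivariate polynomial at the squared variables `x_1², …, x_a²`. -/
noncomputable def sqEval {a : ℕ} (p : MvPolynomial (Fin a) ℤ) : OPol a :=
  ∑ m ∈ p.support,
    MvPolynomial.coeff m p • ((List.finRange a).map fun i => OX i ^ (2 * m i)).prod

/-- The odd symmetrization operator `S(f) = (−1)^{C(a,3)} w₀(D_a(f·x^{δ_a}))`. -/
noncomputable def oddSymzn (a : ℕ) (d : ℕ → OPol a →+ OPol a) (W0 : OPol a →+* OPol a)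
    (f : OPol a) : OPol a :=
  (-1 : OPol a) ^ Nat.choose a 3 * W0 (dword d (DList a) (f * xdelta a))

/-- The odd Schur polynomial `s_α = (−1)^{C(a,3)} w₀(D_a(x^α·x^{δ_a}))`. -/
noncomputable def schurP (a : ℕ) (d : ℕ → OPol a →+ OPol a) (W0 : OPol a →+* OPol a)
    (α : Fin a → ℕ) : OPol a :=
  (-1 : OPol a) ^ Nat.choose a 3 * W0 (dword d (DList a) (xmon α * xdelta a))

/-- The 0-Hecke generator `∂̄_r = x_r ∘ ∂_r`. -/
noncomputable def dbar (a : ℕ) (d : ℕ → OPol a →+ OPol a) (r : ℕ) : OPol a →+ OPol a :=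
  (AddMonoidHom.mulLeft (xv a r)).comp (d r)

/-- The `ℤ`-span of products of exactly `n` variables: the degree-`2n` component of `OPol a`. -/
def degComp (a n : ℕ) : Submodule ℤ (OPol a) :=
  Submodule.span ℤ {f : OPol a | ∃ l : List (Fin a), l.length = n ∧ f = (l.map OX).prod}

/-- Odd Schubert polynomial `𝔰_w = ∂_{w⁻¹w₀}(x^{δ_a})` for a fixed choice `red` of
reduced expressions. -/
noncomputable def schubert (a : ℕ) (d : ℕ → OPol a →+ OPol a)
    (red : Equiv.Perm (Fin a) → List ℕ) (w : Equiv.Perm (Fin a)) : OPol a :=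
  dword d (red (w⁻¹ * Fin.revPerm)) (xdelta a)

/-- Product of odd elementary symmetric polynomials along the parts of a partition,
in non-increasing order. -/
noncomputable def epsPart (a : ℕ) {n : ℕ} (p : Nat.Partition n) : OPol a :=
  (((p.parts.sort (· ≤ ·)).reverse).map (eps a)).prod

/-! ### Words in the generators of a nilCoxeter monoid -/

section Words

variable {M : Type*}

/-- The ascending word `d_{n-m+1} ⋯ d_{n-1} d_n` of length `m` (for `m ≤ n`). -/
def ascWord [Monoid M] (d : ℕ → M) : ℕ → ℕ → M
  | _, 0 => 1
  | 0, _ + 1 => 1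
  | n + 1, m + 1 => ascWord d n m * d (n + 1)

/-- The descending word `d_{m+k} ⋯ d_{m+1}` of length `k`. -/
def descWord [Monoid M] (d : ℕ → M) (m : ℕ) : ℕ → M
  | 0 => 1
  | k + 1 => d (m + k + 1) * descWord d m k

/-- The word `d_1 (d_2 d_1) ⋯ (d_{n-1} ⋯ d_1)` for the longest element of `S_n`. -/
def longestWord [Monoid M] (d : ℕ → M) : ℕ → M
  | 0 => 1
  | n + 1 => longestWord d n * descWord d 0 n

/-- The word for the longest element of `S_n` read as
`(d_1 ⋯ d_{n-1}) (d_1 ⋯ d_{n-2}) ⋯ d_1`. -/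
def longestWord' [Monoid M] (d : ℕ → M) : ℕ → M
  | 0 => 1
  | n + 1 => ascWord d n n * longestWord' d n

theorem map_ascWord {N : Type*} [Monoid M] [Monoid N] (φ : M →* N) (d : ℕ → M) (n m : ℕ) :
    φ (ascWord d n m) = ascWord (fun i => φ (d i)) n m := by
  induction n generalizing m with
  | zero => cases m <;> simp [ascWord]
  | succ n ih => cases m <;> simp [ascWord, ih]

theorem map_descWord {N : Type*} [Monoid M] [Monoid N] (φ : M →* N) (d : ℕ → M) (m k : ℕ) :
    φ (descWord d m k) = descWord (fun i => φ (d i)) m k := by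
  induction k with
  | zero => simp [descWord]
  | succ k ih => simp [descWord, ih]

theorem map_longestWord {N : Type*} [Monoid M] [Monoid N] (φ : M →* N) (d : ℕ → M) (n : ℕ) :
    φ (longestWord d n) = longestWord (fun i => φ (d i)) n := by
  induction n with
  | zero => simp [longestWord]
  | succ n ih => simp [longestWord, ih, map_descWord]

/-- The nilCoxeter relations of type `A`. -/
structure IsNilCoxeter [MonoidWithZero M] (d : ℕ → M) : Prop where
  sq (i : ℕ) : d i * d i = 0
  comm (i j : ℕ) (h : i + 2 ≤ j) : Commute (d i) (d j)
  braid (i : ℕ) : d i * (d (i + 1) * d i) = d (i + 1) * (d i * d (i + 1))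

namespace IsNilCoxeter

variable [MonoidWithZero M] {d : ℕ → M} (hd : IsNilCoxeter d)
include hd

theorem commute_ascWord {n k : ℕ} (h : n + 2 ≤ k) (m : ℕ) : Commute (ascWord d n m) (d k) := by
  induction n generalizing m with
  | zero => cases m <;> simp [ascWord]
  | succ n ih =>
    cases m with
    | zero => simp [ascWord]
    | succ m => exact (ih (by omega) m).mul_left (hd.comm _ _ (by omega))

theorem commute_descWord {m l k : ℕ} (h : m + l + 2 ≤ k) : Commute (descWord d m l) (d k) := by
  induction l with
  | zero => simp [descWord]
  | succ l ih => exact (hd.comm _ _ (by omega)).mul_left (ih (by omega))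

theorem commute_longestWord {n k : ℕ} (h : n + 1 ≤ k) : Commute (longestWord d n) (d k) := by
  induction n with
  | zero => simp [longestWord]
  | succ n ih => exact (ih (by omega)).mul_left (hd.commute_descWord (by omega))

theorem longestWord_succ (n : ℕ) :
    longestWord d (n + 1) = ascWord d n n * longestWord d n := by
  induction n with
  | zero => simp [longestWord, descWord, ascWord]
  | succ n ih =>
    have hc := hd.commute_longestWord (le_refl (n + 1))
    calc longestWord d (n + 2)
        = longestWord d (n + 1) * (d (0 + n + 1) * descWord d 0 n) := rfl
      _ = ascWord d n n * (longestWord d n * d (n + 1)) * descWord d 0 n := by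
          rw [ih, Nat.zero_add]; simp only [mul_assoc]
      _ = ascWord d n n * d (n + 1) * (longestWord d n * descWord d 0 n) := by
          rw [hc.eq]; simp only [mul_assoc]

theorem gen_mul_ascWord (n : ℕ) :
    d (n + 2) * ascWord d (n + 2) (n + 2) = ascWord d (n + 2) (n + 2) * d (n + 1) := by
  have hc := hd.commute_ascWord (le_refl (n + 2)) n
  calc d (n + 2) * (ascWord d n n * d (n + 1) * d (n + 2))
      = ascWord d n n * (d (n + 2) * (d (n + 1) * d (n + 2))) := by
        rw [← mul_assoc, ← mul_assoc, ← hc.eq]; simp only [mul_assoc]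
    _ = ascWord d n n * d (n + 1) * d (n + 2) * d (n + 1) := by
        rw [← hd.braid (n + 1)]; simp only [mul_assoc]

theorem ascWord_mul_ascWord {n m : ℕ} (h : m ≤ n) :
    ascWord d (n + 1) m * ascWord d (n + 1) (n + 1) =
      ascWord d (n + 1) (n + 1) * ascWord d n m := by
  induction n generalizing m with
  | zero =>
    obtain rfl : m = 0 := by omega
    simp [ascWord]
  | succ n ih =>
    cases m with
    | zero => simp [ascWord]
    | succ m =>
      have hc := hd.commute_ascWord (le_refl (n + 2)) m
      calc ascWord d (n + 1) m * d (n + 2) * ascWord d (n + 2) (n + 2)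
          = ascWord d (n + 1) m * (ascWord d (n + 1) (n + 1) * d (n + 2) * d (n + 1)) := by
            rw [mul_assoc, hd.gen_mul_ascWord]; rfl
        _ = ascWord d (n + 1) (n + 1) * (ascWord d n m * d (n + 2)) * d (n + 1) := by
            simp only [← mul_assoc]; rw [ih (by omega)]
        _ = ascWord d (n + 1) (n + 1) * d (n + 2) * (ascWord d n m * d (n + 1)) := by
            rw [hc.eq]; simp only [mul_assoc]

/-- Factorisations of the longest word interpolating between `D_n (d_n ⋯ d_1)` and
`(d_1 ⋯ d_n) D_n`. -/
theorem ascWord_mul_longestWord_mul_descWord (m k : ℕ) :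
    ascWord d (m + k) m * longestWord d (m + k) * descWord d m k =
      longestWord d (m + k + 1) := by
  induction k with
  | zero => simp [descWord, hd.longestWord_succ m]
  | succ k ih =>
    have hc := hd.commute_longestWord (le_refl (m + k + 1))
    calc ascWord d (m + k + 1) m * longestWord d (m + k + 1) *
          (d (m + k + 1) * descWord d m k)
        = ascWord d (m + k + 1) m * (ascWord d (m + k) (m + k) *
            (longestWord d (m + k) * d (m + k + 1))) * descWord d m k := by
          rw [hd.longestWord_succ (m + k)]; simp only [mul_assoc]
      _ = ascWord d (m + k + 1) m * ascWord d (m + k + 1) (m + k + 1) *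
            (longestWord d (m + k) * descWord d m k) := by
          rw [hc.eq]; simp only [ascWord, mul_assoc]
      _ = ascWord d (m + k + 1) (m + k + 1) *
            (ascWord d (m + k) m * longestWord d (m + k) * descWord d m k) := by
          rw [hd.ascWord_mul_ascWord (by omega)]; simp only [mul_assoc]
      _ = longestWord d (m + k + 2) := by rw [ih, ← hd.longestWord_succ (m + k + 1)]

theorem longestWord_mul_gen (n : ℕ) : longestWord d (n + 2) * d (n + 1) = 0 := by
  induction n with
  | zero => simp [longestWord, descWord, hd.sq]
  | succ n ih =>
    have hc := hd.commute_descWord (m := 0) (l := n) (k := n + 2) (by omega)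
    calc longestWord d (n + 2) * (d (0 + (n + 1) + 1) * (d (0 + n + 1) * descWord d 0 n)) *
          d (n + 2)
        = longestWord d (n + 2) * (d (n + 2) * (d (n + 1) * d (n + 2))) * descWord d 0 n := by
          simp only [Nat.zero_add, mul_assoc]; rw [hc.eq]
      _ = longestWord d (n + 2) * d (n + 1) * d (n + 2) * d (n + 1) * descWord d 0 n := by
          rw [← hd.braid (n + 1)]; simp only [mul_assoc]
      _ = 0 := by rw [ih]; simp

theorem gen_mul_longestWord {i n : ℕ} (hi : 1 ≤ i) (h : i < n) :
    d i * longestWord d n = 0 := by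
  induction n generalizing i with
  | zero => omega
  | succ n ih =>
    rcases Nat.lt_or_ge i n with hin | hin
    · rw [longestWord, ← mul_assoc, ih hi hin, zero_mul]
    · obtain rfl : i = n := by omega
      rw [hd.longestWord_succ]
      match i, hi with
      | 1, _ => simp [ascWord, longestWord, descWord, hd.sq]
      | i + 2, _ =>
        rw [← mul_assoc, hd.gen_mul_ascWord, mul_assoc, ih (by omega) (by omega), mul_zero]

end IsNilCoxeter

end Words

/-! ### The multiplicative monoid of a ring modulo sign -/

section Sign

/-- The congruence identifying elements of a ring that agree up to sign. -/
def signCon (R : Type*) [Ring R] : Con R where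
  r x y := x = y ∨ x = -y
  iseqv := by
    refine ⟨fun x => Or.inl rfl, ?_, ?_⟩
    · rintro x y (rfl | rfl) <;> simp
    · rintro x y z (rfl | rfl) (rfl | rfl) <;> simp
  mul' := by
    rintro w x y z (rfl | rfl) (rfl | rfl) <;> simp

theorem signCon_coe_eq {R : Type*} [Ring R] {x y : R} :
    (x : (signCon R).Quotient) = y ↔ x = y ∨ x = -y :=
  (signCon R).eq

instance (R : Type*) [Ring R] : MonoidWithZero (signCon R).Quotient where
  zero := ((0 : R) : (signCon R).Quotient)
  zero_mul x := by
    induction x using Con.induction_on with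
    | H x => exact congrArg (fun y : R => (y : (signCon R).Quotient)) (zero_mul x)
  mul_zero x := by
    induction x using Con.induction_on with
    | H x => exact congrArg (fun y : R => (y : (signCon R).Quotient)) (mul_zero x)

theorem signCon_coe_eq_zero {R : Type*} [Ring R] {x : R} :
    (x : (signCon R).Quotient) = 0 ↔ x = 0 := by
  have h : (x : (signCon R).Quotient) = ((0 : R) : (signCon R).Quotient) ↔ x = 0 := by
    rw [signCon_coe_eq]; simp
  exact h

end Sign

/-! ### Odd divided differences on a ring generated by variables -/

/-- An additive map on a ring generated by a set `X` is determined by its value at `1` and its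
behaviour under left multiplication by elements of `X`. -/
theorem AddMonoidEnd.ext_of_closure_eq_top {R : Type*} [Ring R] {X : Set R}
    (hX : Subring.closure X = ⊤) {S T : AddMonoid.End R} (h1 : S 1 = T 1)
    (hx : ∀ x ∈ X, ∀ g, S g = T g → S (x * g) = T (x * g)) : S = T := by
  have key : ∀ u ∈ Subring.closure X, ∀ g, S g = T g → S (u * g) = T (u * g) := by
    intro u hu
    induction hu using Subring.closure_induction with
    | mem x h => exact hx x h
    | zero => simp
    | one => simp
    | add u v _ _ hu hv => intro g hg; simp [add_mul, hu g hg, hv g hg]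
    | neg u _ hu => intro g hg; simp [hu g hg]
    | mul u v _ _ hu hv => intro g hg; rw [mul_assoc]; exact hu _ (hv g hg)
  ext f
  simpa using key f (hX ▸ Subring.mem_top f) 1 h1

/-- The signed simple transpositions `s` and the odd divided difference operators `d` in the
variables `x_1, …, x_a`, with `d_i` extended by zero outside `1 ≤ i < a`. -/
structure IsOddDivDiff {R : Type*} [Ring R] (a : ℕ) (x : ℕ → R) (s : ℕ → R →+* R)
    (d : ℕ → AddMonoid.End R) : Prop where
  closure : Subring.closure (x '' Set.Icc 1 a) = ⊤
  perm_var : ∀ i j : ℕ, 1 ≤ i → i + 1 ≤ a → 1 ≤ j → j ≤ a →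
    s i (x j) = if j = i then -x (i + 1) else if j = i + 1 then -x i else -x j
  one : ∀ i : ℕ, 1 ≤ i → i + 1 ≤ a → d i 1 = 0
  var : ∀ i j : ℕ, 1 ≤ i → i + 1 ≤ a → 1 ≤ j → j ≤ a →
    d i (x j) = if j = i ∨ j = i + 1 then 1 else 0
  leibniz : ∀ i : ℕ, 1 ≤ i → i + 1 ≤ a → ∀ f g : R,
    d i (f * g) = d i f * g + s i f * d i g
  eq_zero : ∀ i : ℕ, ¬(1 ≤ i ∧ i + 1 ≤ a) → d i = 0

namespace IsOddDivDiff

variable {R : Type*} [Ring R] {a : ℕ} {x : ℕ → R} {s : ℕ → R →+* R} {d : ℕ → AddMonoid.End R}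
  (H : IsOddDivDiff a x s d)
include H

theorem ext {S T : AddMonoid.End R} (h1 : S 1 = T 1)
    (hx : ∀ j, 1 ≤ j → j ≤ a → ∀ g, S g = T g → S (x j * g) = T (x j * g)) : S = T :=
  AddMonoidEnd.ext_of_closure_eq_top H.closure h1 (by
    rintro _ ⟨j, ⟨h1, h2⟩, rfl⟩
    exact hx j h1 h2)

theorem apply_one (i : ℕ) : d i 1 = 0 := by
  by_cases h : 1 ≤ i ∧ i + 1 ≤ a
  · exact H.one i h.1 h.2
  · rw [H.eq_zero i h]; rfl

theorem var_mul_left {i : ℕ} (hi : 1 ≤ i) (hia : i + 1 ≤ a) (g : R) :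
    d i (x i * g) = g - x (i + 1) * d i g := by
  rw [H.leibniz i hi hia, H.var i i hi hia hi (by omega), H.perm_var i i hi hia hi (by omega)]
  simp [sub_eq_add_neg]

theorem var_mul_right {i : ℕ} (hi : 1 ≤ i) (hia : i + 1 ≤ a) (g : R) :
    d i (x (i + 1) * g) = g - x i * d i g := by
  rw [H.leibniz i hi hia, H.var i (i + 1) hi hia (by omega) hia,
    H.perm_var i (i + 1) hi hia (by omega) hia]
  simp [sub_eq_add_neg]

theorem var_mul_of_ne {i j : ℕ} (hi : 1 ≤ i) (hia : i + 1 ≤ a) (hj : 1 ≤ j) (hja : j ≤ a)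
    (h : j ≠ i) (h' : j ≠ i + 1) (g : R) : d i (x j * g) = -(x j * d i g) := by
  rw [H.leibniz i hi hia, H.var i j hi hia hj hja, H.perm_var i j hi hia hj hja]
  simp [h, h']

theorem mul_of_apply_eq_zero {i : ℕ} {h : R} (hh : d i h = 0) (g : R) :
    d i (g * h) = d i g * h := by
  by_cases hi : 1 ≤ i ∧ i + 1 ≤ a
  · rw [H.leibniz i hi.1 hi.2, hh, mul_zero, add_zero]
  · rw [H.eq_zero i hi]; simp

theorem sq (i : ℕ) : d i * d i = 0 := by
  by_cases hi : 1 ≤ i ∧ i + 1 ≤ a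
  swap
  · rw [H.eq_zero i hi, zero_mul]
  obtain ⟨hi, hia⟩ := hi
  refine H.ext (by simp [H.apply_one]) fun j hj hja g hg => ?_
  replace hg : d i (d i g) = 0 := hg
  change d i (d i (x j * g)) = 0
  by_cases h : j = i
  · subst h
    rw [H.var_mul_left hi hia, map_sub, H.var_mul_right hi hia, hg]; simp
  by_cases h' : j = i + 1
  · subst h'
    rw [H.var_mul_right hi hia, map_sub, H.var_mul_left hi hia, hg]; simp
  rw [H.var_mul_of_ne hi hia hj hja h h', map_neg, H.var_mul_of_ne hi hia hj hja h h', hg]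
  simp

theorem anticomm {i k : ℕ} (hik : i + 2 ≤ k) : d i * d k = -(d k * d i) := by
  by_cases hi : 1 ≤ i ∧ i + 1 ≤ a
  swap
  · simp [H.eq_zero i hi]
  by_cases hk : 1 ≤ k ∧ k + 1 ≤ a
  swap
  · simp [H.eq_zero k hk]
  obtain ⟨hi, hia⟩ := hi
  obtain ⟨hk, hka⟩ := hk
  refine H.ext (by
    change d i (d k 1) = -d k (d i 1)
    simp [H.apply_one]) fun j hj hja g hg => ?_
  replace hg : d i (d k g) = -d k (d i g) := hg
  change d i (d k (x j * g)) = -d k (d i (x j * g))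
  by_cases h1 : j = i
  · subst h1
    rw [H.var_mul_of_ne hk hka hj hja (by omega) (by omega), H.var_mul_left hi hia, map_neg,
      map_sub, H.var_mul_left hi hia,
      H.var_mul_of_ne hk hka (by omega) (by omega) (by omega) (by omega), hg]
    simp
  by_cases h2 : j = i + 1
  · subst h2
    rw [H.var_mul_of_ne hk hka hj hja (by omega) (by omega), H.var_mul_right hi hia, map_neg,
      map_sub, H.var_mul_right hi hia,
      H.var_mul_of_ne hk hka (by omega) (by omega) (by omega) (by omega), hg]
    simp
  by_cases h3 : j = k
  · subst h3
    rw [H.var_mul_of_ne hi hia hj hja (by omega) (by omega), H.var_mul_left hk hka, map_neg,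
      map_sub, H.var_mul_left hk hka,
      H.var_mul_of_ne hi hia (by omega) (by omega) (by omega) (by omega), hg]
    simp
  by_cases h4 : j = k + 1
  · subst h4
    rw [H.var_mul_of_ne hi hia hj hja (by omega) (by omega), H.var_mul_right hk hka, map_neg,
      map_sub, H.var_mul_right hk hka,
      H.var_mul_of_ne hi hia (by omega) (by omega) (by omega) (by omega), hg]
    simp
  rw [H.var_mul_of_ne hi hia hj hja h1 h2, H.var_mul_of_ne hk hka hj hja h3 h4, map_neg, map_neg,
    H.var_mul_of_ne hi hia hj hja h1 h2, H.var_mul_of_ne hk hka hj hja h3 h4, hg]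
  simp

theorem braid (i : ℕ) : d i * (d (i + 1) * d i) = d (i + 1) * (d i * d (i + 1)) := by
  by_cases hi : 1 ≤ i ∧ i + 1 ≤ a
  swap
  · simp [H.eq_zero i hi]
  by_cases hk : 1 ≤ i + 1 ∧ i + 1 + 1 ≤ a
  swap
  · simp [H.eq_zero (i + 1) hk]
  obtain ⟨hi, hia⟩ := hi
  obtain ⟨hk, hka⟩ := hk
  have sq1 (g) : d i (d i g) = 0 := DFunLike.congr_fun (H.sq i) g
  have sq2 (g) : d (i + 1) (d (i + 1) g) = 0 := DFunLike.congr_fun (H.sq (i + 1)) g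
  have e1 := H.var_mul_left hi hia
  have e2 := H.var_mul_right hi hia
  have e3 := H.var_mul_of_ne hi hia (j := i + 1 + 1) (by omega) hka (by omega) (by omega)
  have k1 := H.var_mul_of_ne hk hka (j := i) hi (by omega) (by omega) (by omega)
  have k2 := H.var_mul_left hk hka
  have k3 := H.var_mul_right hk hka
  refine H.ext (by simp [H.apply_one]) fun j hj hja g hg => ?_
  replace hg : d i (d (i + 1) (d i g)) = d (i + 1) (d i (d (i + 1) g)) := hg
  change d i (d (i + 1) (d i (x j * g))) = d (i + 1) (d i (d (i + 1) (x j * g)))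
  by_cases h1 : j = i
  · subst h1
    simp [e1, e3, k1, k2, sq1, sq2, hg]
  by_cases h2 : j = i + 1
  · subst h2
    simp only [e1, e2, e3, k1, k2, k3, map_sub, map_neg, hg]
    abel
  by_cases h3 : j = i + 1 + 1
  · subst h3
    simp [e2, e3, k1, k3, sq1, sq2, hg]
  have e4 := H.var_mul_of_ne hi hia hj hja h1 h2
  have k4 := H.var_mul_of_ne hk hka hj hja h2 h3
  simp [e4, k4, hg]

theorem isNilCoxeter :
    IsNilCoxeter fun i => (signCon (AddMonoid.End R)).mk' (d i) where
  sq i := signCon_coe_eq_zero.2 (H.sq i)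
  comm _ _ h := signCon_coe_eq.2 (Or.inr (H.anticomm h))
  braid i := signCon_coe_eq.2 (Or.inl (H.braid i))

theorem longestWord_succ (n : ℕ) :
    longestWord d (n + 1) = ascWord d n n * longestWord d n ∨
      longestWord d (n + 1) = -(ascWord d n n * longestWord d n) := by
  have := H.isNilCoxeter.longestWord_succ n
  simp only [← map_longestWord (signCon _).mk' d, ← map_ascWord (signCon _).mk' d,
    ← map_mul] at this
  exact signCon_coe_eq.1 this

theorem gen_longestWord {i n : ℕ} (hi : 1 ≤ i) (h : i < n) (g : R) :
    d i (longestWord d n g) = 0 := by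
  have := H.isNilCoxeter.gen_mul_longestWord hi h
  simp only [← map_longestWord (signCon _).mk' d] at this
  exact DFunLike.congr_fun (signCon_coe_eq_zero.1 this) g

theorem longestWord_gen (n : ℕ) (g : R) : longestWord d (n + 2) (d (n + 1) g) = 0 := by
  have := H.isNilCoxeter.longestWord_mul_gen n
  simp only [← map_longestWord (signCon _).mk' d] at this
  exact DFunLike.congr_fun (signCon_coe_eq_zero.1 this) g

theorem ascWord_longestWord_descWord (m k : ℕ) :
    ascWord d (m + k) m * longestWord d (m + k) * descWord d m k = longestWord d (m + k + 1) ∨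
      ascWord d (m + k) m * longestWord d (m + k) * descWord d m k =
        -longestWord d (m + k + 1) := by
  have := H.isNilCoxeter.ascWord_mul_longestWord_mul_descWord m k
  simp only [← map_longestWord (signCon _).mk' d, ← map_ascWord (signCon _).mk' d,
    ← map_descWord (signCon _).mk' d, ← map_mul] at this
  exact signCon_coe_eq.1 this

/-! ### Right linearity and an element on which the longest word is a unit -/

theorem ascWord_mul_right {n : ℕ} {h : R} (hh : ∀ i, 1 ≤ i → i ≤ n → d i h = 0) (m : ℕ)
    (g : R) : ascWord d n m (g * h) = ascWord d n m g * h := by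
  induction n generalizing m g with
  | zero => cases m <;> simp [ascWord]
  | succ n ih =>
    cases m with
    | zero => simp [ascWord]
    | succ m =>
      change ascWord d n m (d (n + 1) (g * h)) = _
      rw [H.mul_of_apply_eq_zero (hh _ (by omega) le_rfl),
        ih (fun i h1 h2 => hh i h1 (by omega))]
      rfl

theorem descWord_mul_right {m k : ℕ} {h : R}
    (hh : ∀ i, m + 1 ≤ i → i ≤ m + k → d i h = 0) (g : R) :
    descWord d m k (g * h) = descWord d m k g * h := by
  induction k with
  | zero => simp [descWord]
  | succ k ih =>
    change d (m + k + 1) (descWord d m k (g * h)) = _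
    rw [ih (fun i h1 h2 => hh i h1 (by omega)),
      H.mul_of_apply_eq_zero (hh _ (by omega) (by omega))]
    rfl

theorem longestWord_mul_right {n : ℕ} {h : R} (hh : ∀ i, 1 ≤ i → i < n → d i h = 0)
    (g : R) : longestWord d n (g * h) = longestWord d n g * h := by
  induction n generalizing g with
  | zero => simp [longestWord]
  | succ n ih =>
    change longestWord d n (descWord d 0 n (g * h)) = _
    rw [H.descWord_mul_right (fun i h1 h2 => hh i (by omega) (by omega)),
      ih (fun i h1 h2 => hh i h1 (by omega))]
    rfl

theorem exists_ascWord_eq_one {n : ℕ} (hn : n + 1 ≤ a) :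
    ∃ q : R, (∀ i, i ≠ n → d i q = 0) ∧ (1 ≤ n → x n * d n q = q) ∧ ascWord d n n q = 1 := by
  induction n with
  | zero => exact ⟨1, fun i _ => H.apply_one i, by omega, rfl⟩
  | succ n ih =>
    obtain ⟨q, h1, h2, h3⟩ := ih (by omega)
    have hq : d (n + 1) (x (n + 1) * q) = q := by
      rw [H.var_mul_left (by omega) hn, h1 (n + 1) (by omega)]; simp
    refine ⟨x (n + 1) * q, fun i hi => ?_, fun _ => by rw [hq], ?_⟩
    · by_cases hr : 1 ≤ i ∧ i + 1 ≤ a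
      swap
      · rw [H.eq_zero i hr]; rfl
      by_cases hin : i = n
      · subst hin
        rw [H.var_mul_right hr.1 hr.2, h2 hr.1, sub_self]
      · rw [H.var_mul_of_ne hr.1 hr.2 (by omega) (by omega) (by omega) (by omega), h1 i hin]
        simp
    · change ascWord d n n (d (n + 1) (x (n + 1) * q)) = 1
      rw [hq, h3]

theorem exists_longestWord_eq_one {n : ℕ} (hn : n ≤ a) :
    ∃ z : R, longestWord d n z = 1 := by
  induction n with
  | zero => exact ⟨1, rfl⟩
  | succ n ih =>
    obtain ⟨z, hz⟩ := ih (by omega)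
    obtain ⟨q, hq, -, hq1⟩ := H.exists_ascWord_eq_one hn
    have key : ascWord d n n (longestWord d n (z * q)) = 1 := by
      rw [H.longestWord_mul_right fun i _ h2 => hq i (by omega), hz, one_mul, hq1]
    rcases H.longestWord_succ n with h | h
    · exact ⟨z * q, by rw [h]; exact key⟩
    · refine ⟨-(z * q), ?_⟩
      rw [h, map_neg]
      change - -(ascWord d n n (longestWord d n (z * q))) = 1
      rw [neg_neg, key]

/-! ### Twisted left linearity -/

/-- If `d_i f = 0`, then left multiplication by `f` preserves the image of `d_i`. -/
theorem exists_mul_apply_eq {i : ℕ} (hi : 1 ≤ i) (hia : i + 1 ≤ a) {f : R} (hf : d i f = 0)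
    (g : R) : ∃ p, f * d i g = d i p := by
  have h0 : d i (f * d i g) = 0 := by
    rw [H.leibniz i hi hia, hf, show d i (d i g) = 0 from DFunLike.congr_fun (H.sq i) g]
    simp
  exact ⟨x i * (f * d i g), by rw [H.var_mul_left hi hia, h0]; simp⟩

/-- A twisted linearity criterion for `d_1 ⋯ d_n` on `⋂_{i < n} ker d_i`, in terms of a
triangular family of test elements. -/
theorem ascWord_twisted_linear {n : ℕ} (hn : n + 1 ≤ a) (F : R)
    (test : ∀ m < n, ∃ h, (∀ i, 1 ≤ i → i < n → d i h = 0) ∧ ascWord d n n (F * h) = 0 ∧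
      (ascWord d n m h = 1 ∨ ascWord d n m h = -1))
    {h : R} (hh : ∀ i, 1 ≤ i → i < n → d i h = 0) :
    ascWord d n n (F * h) = ascWord s n n F * ascWord d n n h := by
  induction n generalizing F h with
  | zero => rfl
  | succ n ih =>
    have hF : ascWord d (n + 1) (n + 1) F = 0 := by
      obtain ⟨h0, -, h1, h2⟩ := test 0 (by omega)
      replace h2 : h0 = 1 ∨ h0 = -1 := h2
      rcases h2 with rfl | rfl
      · simpa using h1
      · simpa using h1
    have expand : ∀ k : R, (∀ i, 1 ≤ i → i < n + 1 → d i k = 0) →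
        ascWord d (n + 1) (n + 1) (F * k) = ascWord d n n (s (n + 1) F * d (n + 1) k) := by
      intro k hk
      change ascWord d n n (d (n + 1) (F * k)) = _
      rw [H.leibniz _ (by omega) hn, map_add,
        H.ascWord_mul_right (fun i h1 h2 => hk i h1 (by omega)),
        show ascWord d n n (d (n + 1) F) = 0 from hF, zero_mul, zero_add]
    have descend : ∀ k : R, (∀ i, 1 ≤ i → i < n + 1 → d i k = 0) →
        ∀ i, 1 ≤ i → i < n → d i (d (n + 1) k) = 0 := by
      intro k hk i h1 h2
      have := DFunLike.congr_fun (H.anticomm (show i + 2 ≤ n + 1 by omega)) k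
      change d i (d (n + 1) k) = -d (n + 1) (d i k) at this
      rw [this, hk i h1 (by omega)]
      simp
    rw [expand h hh]
    refine ih (by omega) (s (n + 1) F) (fun m hm => ?_) (descend h hh)
    obtain ⟨k, hk1, hk2, hk3⟩ := test (m + 1) (by omega)
    exact ⟨d (n + 1) k, descend k hk1, by rw [← expand k hk1, hk2], hk3⟩

theorem longestWord_twisted_linear {n : ℕ} (hn : n ≤ a) {f : R}
    (hf : ∀ i, 1 ≤ i → i < n → d i f = 0) (g : R) :
    longestWord d n (f * g) = longestWord' s n f * longestWord d n g := by
  induction n generalizing g with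
  | zero => rfl
  | succ n ih =>
    replace ih := ih (by omega) (fun i h1 h2 => hf i h1 (by omega))
    obtain ⟨z, hz⟩ := H.exists_longestWord_eq_one hn
    have key : ∀ g, ascWord d n n (longestWord' s n f * longestWord d n g) =
        longestWord' s (n + 1) f * ascWord d n n (longestWord d n g) := by
      intro g
      refine H.ascWord_twisted_linear hn _ (fun m hm => ?_)
        (fun i h1 h2 => H.gen_longestWord h1 h2 g)
      obtain ⟨k, rfl⟩ : ∃ k, n = m + k + 1 := ⟨n - m - 1, by omega⟩
      refine ⟨longestWord d (m + k + 1) (descWord d m (k + 1) z),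
        fun i h1 h2 => H.gen_longestWord h1 h2 _, ?_, ?_⟩
      · obtain ⟨p, hp⟩ := H.exists_mul_apply_eq (i := m + k + 1) (by omega) hn
          (hf _ (by omega) (by omega)) (descWord d m k z)
        change f * descWord d m (k + 1) z = _ at hp
        have h0 := H.longestWord_gen (m + k) p
        rw [← ih, hp]
        rcases H.longestWord_succ (m + k + 1) with h | h
        · rw [h] at h0
          exact h0
        · rw [h] at h0
          exact neg_eq_zero.1 h0
      · rcases H.ascWord_longestWord_descWord m (k + 1) with h | h
        · exact Or.inl ((DFunLike.congr_fun h z).trans hz)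
        · exact Or.inr ((DFunLike.congr_fun h z).trans (congrArg Neg.neg hz))
    rcases H.longestWord_succ n with h | h
    · rw [h]
      change ascWord d n n (longestWord d n (f * g)) = _ * ascWord d n n (longestWord d n g)
      rw [ih, key]
    · rw [h]
      change -ascWord d n n (longestWord d n (f * g)) = _ * -ascWord d n n (longestWord d n g)
      rw [ih, key, mul_neg]

/-! ### The longest element acting on the variables -/

theorem ascWord_perm_var {n j : ℕ} (hn : n + 1 ≤ a) (hj : 1 ≤ j) (hja : j ≤ a) :
    ascWord s n n (x j) =
      (-1) ^ n * x (if j ≤ n then j + 1 else if j = n + 1 then 1 else j) := by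
  induction n generalizing j with
  | zero =>
    change x j = _
    rcases Nat.lt_or_ge 1 j with h | h
    · rw [if_neg (by omega), if_neg (by omega)]; simp
    · obtain rfl : j = 1 := by omega
      simp
  | succ n ih =>
    change ascWord s n n (s (n + 1) (x j)) = _
    rw [H.perm_var (n + 1) j (by omega) hn hj hja]
    by_cases h1 : j = n + 1
    · subst h1
      rw [if_pos rfl, map_neg, ih (by omega) (by omega) (by omega), if_neg (by omega),
        if_neg (by omega), if_pos le_rfl, pow_succ]
      simp
    by_cases h2 : j = n + 1 + 1
    · subst h2
      rw [if_neg (by omega), if_pos rfl, map_neg, ih (by omega) (by omega) (by omega),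
        if_neg (by omega), if_pos rfl, if_neg (by omega), if_pos rfl, pow_succ]
      simp
    rw [if_neg h1, if_neg h2, map_neg, ih (by omega) hj hja, if_neg h2, if_neg h1, pow_succ]
    by_cases h3 : j ≤ n
    · rw [if_pos h3, if_pos (by omega)]; simp
    · rw [if_neg h3, if_neg (by omega)]; simp

theorem longestWord'_perm_var {n j : ℕ} (hn : n ≤ a) (hj : 1 ≤ j) (hja : j ≤ a) :
    longestWord' s n (x j) = (-1) ^ n.choose 2 * x (if j ≤ n then n + 1 - j else j) := by
  induction n with
  | zero => simp [longestWord', show j ≠ 0 by omega]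
  | succ n ih =>
    change ascWord s n n (longestWord' s n (x j)) = _
    have hc : (n + 1).choose 2 = n.choose 2 + n := by
      rw [Nat.choose_succ_succ' n 1, Nat.choose_one_right, add_comm]
    rw [ih (by omega), map_mul, map_pow, map_neg, map_one, hc, pow_add, mul_assoc]
    congr 1
    by_cases h : j ≤ n
    · rw [if_pos h, H.ascWord_perm_var hn (by omega) (by omega), if_pos (by omega),
        if_pos (by omega)]
      congr 2; omega
    · rw [if_neg h, H.ascWord_perm_var hn hj hja, if_neg h]
      congr 2
      split_ifs <;> omega

end IsOddDivDiff

/-! ### Specialisation to odd polynomials -/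

theorem OX_eq_xv {a : ℕ} (i : Fin a) : (OX i : OPol a) = xv a (i + 1) := by
  simp [xv]

theorem closure_xv (a : ℕ) : Subring.closure (xv a '' Set.Icc 1 a) = ⊤ := by
  refine (Subring.eq_top_iff' _).2 fun f => ?_
  obtain ⟨u, rfl⟩ := RingQuot.mkRingHom_surjective (OddRel a) f
  induction u using FreeAlgebra.induction with
  | grade0 r => simp
  | grade1 i =>
    exact Subring.subset_closure ⟨i + 1, ⟨by omega, by omega⟩, (OX_eq_xv i).symm⟩
  | mul u v hu hv => rw [map_mul]; exact Subring.mul_mem _ hu hv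
  | add u v hu hv => rw [map_add]; exact Subring.add_mem _ hu hv

theorem dword_eq_prod {a : ℕ} (d : ℕ → AddMonoid.End (OPol a)) (l : List ℕ) :
    dword (fun i => d i) l = (l.map d).prod := by
  induction l with
  | nil => rfl
  | cons i l ih => exact congrArg (d i * ·) ih

theorem prod_map_reverse_range {M : Type*} [Monoid M] (d : ℕ → M) (n : ℕ) :
    (((List.range n).reverse.map (· + 1)).map d).prod = descWord d 0 n := by
  induction n with
  | zero => rfl
  | succ n ih =>
    rw [descWord, ← ih, Nat.zero_add]
    simp [List.range_succ]

theorem prod_map_DList {M : Type*} [Monoid M] (d : ℕ → M) (n : ℕ) :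
    ((DList n).map d).prod = longestWord d n := by
  induction n with
  | zero => rfl
  | succ n ih =>
    have h : DList (n + 1) = DList n ++ (List.range n).reverse.map (· + 1) := by
      simp [DList, List.range_succ]
    rw [h, List.map_append, List.prod_append, prod_map_reverse_range, ih, longestWord]

theorem mem_DList {a i : ℕ} (h : i ∈ DList a) : 1 ≤ i ∧ i + 1 ≤ a := by
  simp only [DList, List.mem_flatten, List.mem_map, List.mem_range] at h
  obtain ⟨_, ⟨b, hb, rfl⟩, hi⟩ := h
  simp only [List.mem_map, List.mem_reverse, List.mem_range] at hi
  obtain ⟨c, hc, rfl⟩ := hi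
  omega

/-- twisted left linearity of D_a: for f odd symmetric,
D_a(f·g) = w₀(f)·D_a(g). -/
theorem Da_twisted_left_linear (a : ℕ)
    (s : ℕ → OPol a →+* OPol a)
    (hs : ∀ i j : ℕ, 1 ≤ i → i + 1 ≤ a → 1 ≤ j → j ≤ a →
      s i (xv a j) =
        if j = i then -xv a (i + 1) else if j = i + 1 then -xv a i else -xv a j)
    (d : ℕ → OPol a →+ OPol a)
    (hd1 : ∀ i : ℕ, 1 ≤ i → i + 1 ≤ a → d i 1 = 0)
    (hdx : ∀ i j : ℕ, 1 ≤ i → i + 1 ≤ a → 1 ≤ j → j ≤ a →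
      d i (xv a j) = if j = i ∨ j = i + 1 then 1 else 0)
    (hdL : ∀ i : ℕ, 1 ≤ i → i + 1 ≤ a → ∀ f g : OPol a,
      d i (f * g) = d i f * g + s i f * d i g)
    (W0 : OPol a →+* OPol a)
    (hW0 : ∀ i : Fin a, W0 (OX i) = (-1 : OPol a) ^ Nat.choose a 2 * OX (Fin.rev i)) :
    ∀ f g : OPol a, (∀ i : ℕ, 1 ≤ i → i + 1 ≤ a → d i f = 0) →
      dword d (DList a) (f * g) = W0 f * dword d (DList a) g := by
  intro f g hf
  let e : ℕ → AddMonoid.End (OPol a) := fun i => if 1 ≤ i ∧ i + 1 ≤ a then d i else 0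
  have he : ∀ i, 1 ≤ i → i + 1 ≤ a → e i = d i := fun i h1 h2 => if_pos ⟨h1, h2⟩
  have H : IsOddDivDiff a (xv a) s e :=
    { closure := closure_xv a
      perm_var := hs
      one := fun i h1 h2 => by rw [he i h1 h2]; exact hd1 i h1 h2
      var := fun i j h1 h2 h3 h4 => by rw [he i h1 h2]; exact hdx i j h1 h2 h3 h4
      leibniz := fun i h1 h2 => by rw [he i h1 h2]; exact hdL i h1 h2
      eq_zero := fun i hi => if_neg hi }
  have hW : W0 = longestWord' s a := by
    refine RingHom.eq_of_eqOn_set_top fun u _ => ?_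
    have hu : u ∈ Subring.closure (xv a '' Set.Icc 1 a) := closure_xv a ▸ Subring.mem_top u
    refine RingHom.eqOn_set_closure (f := W0) (g := longestWord' s a) ?_ hu
    rintro _ ⟨j, ⟨h1, h2⟩, rfl⟩
    have hj := hW0 ⟨j - 1, by omega⟩
    rw [OX_eq_xv, OX_eq_xv] at hj
    simp only [Fin.val_rev, Nat.sub_add_cancel h1] at hj
    rw [hj, H.longestWord'_perm_var le_rfl h1 h2, if_pos h2]
    congr 2
    omega
  have hD : dword d (DList a) = longestWord e a := by
    rw [← prod_map_DList]
    refine (dword_eq_prod d (DList a)).trans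
      (congrArg (List.prod (α := AddMonoid.End (OPol a))) ?_)
    exact List.map_congr_left fun i hi => (he i (mem_DList hi).1 (mem_DList hi).2).symm
  rw [hD, hW]
  refine H.longestWord_twisted_linear le_rfl (fun i h1 h2 => ?_) g
  rw [he i h1 h2]
  exact hf i h1 h2
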